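/- Let n and k be integers with k ≥ 1 and 2k < n. Set C(k,n) = Γ(n/2+1−k)/(2^{2k−1}·(k−1)!·Γ(n/2+1)) and, for 0 < r ≤ s, φ_k(r,s) = C(k,n)·s^{2k−2−n}·∑_{j=0}^{k−1} (−1)^j·binom(k−1,j)·((n/2+1−k)_j/(n/2+1)_j)·(r/s)^{2j}; in particular φ_1(r,s) = s^{−n}/n. Define φ̂_k(σ,τ) = φ_k(min(σ,τ), max(σ,τ)) for σ, τ > 0. Then for all 0 < r ≤ s, the function σ ↦ σ^{n+1}·φ̂_k(σ,r)·φ̂_1(σ,s) is integrable on (0,∞) and ∫_0^∞ σ^{n+1}·φ̂_k(σ,r)·φ̂_1(σ,s) dσ = φ_{k+1}(r,s). -/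

import Mathlib

open MeasureTheory

/-- The rising factorial (Pochhammer symbol) `(x)_j = x(x+1)⋯(x+j-1)`. -/
noncomputable def risingFactorial (j : ℕ) (x : ℝ) : ℝ := (ascPochhammer ℝ j).eval x

/-- The constant `C(k,n) = Γ(n/2+1-k)/(2^{2k-1} (k-1)! Γ(n/2+1))`. -/
noncomputable def Ckn (k n : ℕ) : ℝ :=
  Real.Gamma ((n : ℝ) / 2 + 1 - k)
    / (2 ^ (2 * k - 1) * (Nat.factorial (k - 1) : ℝ) * Real.Gamma ((n : ℝ) / 2 + 1))

/-- The kernel factor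
`φ_k(r,s) = C(k,n) s^{2k-2-n} ∑_{j=0}^{k-1} (-1)^j binom(k-1,j) ((n/2+1-k)_j/(n/2+1)_j) (r/s)^{2j}`,
the finite sum being the terminating hypergeometric series `F(1-k, n/2+1-k; n/2+1; r²/s²)`. -/
noncomputable def phiK (k n : ℕ) (r s : ℝ) : ℝ :=
  Ckn k n * s ^ (2 * (k : ℤ) - 2 - (n : ℤ))
    * ∑ j ∈ Finset.range k,
        (-1 : ℝ) ^ j * (Nat.choose (k - 1) j : ℝ)
          * (risingFactorial j ((n : ℝ) / 2 + 1 - k) / risingFactorial j ((n : ℝ) / 2 + 1))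
          * (r / s) ^ (2 * j)

/-- The symmetrized kernel `φ̂_k(σ,τ) = φ_k(min(σ,τ), max(σ,τ))`. -/
noncomputable def phiKHat (k n : ℕ) (σ τ : ℝ) : ℝ := phiK k n (min σ τ) (max σ τ)

/-- The coefficient of `(r/s)^{2j}` in the finite sum defining `phiK k n r s`. -/
noncomputable def phiCoeff (k n j : ℕ) : ℝ :=
  (-1 : ℝ) ^ j * (Nat.choose (k - 1) j : ℝ)
    * (risingFactorial j ((n : ℝ) / 2 + 1 - k) / risingFactorial j ((n : ℝ) / 2 + 1))

lemma risingFactorial_zero (x : ℝ) : risingFactorial 0 x = 1 := by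
  simp [risingFactorial]

lemma risingFactorial_succ (j : ℕ) (x : ℝ) :
    risingFactorial (j + 1) x = risingFactorial j x * (x + j) := by
  simp [risingFactorial, ascPochhammer_succ_right]

lemma risingFactorial_pos (j : ℕ) {x : ℝ} (hx : 0 < x) : 0 < risingFactorial j x :=
  ascPochhammer_pos j x hx

lemma risingFactorial_mul_add (j : ℕ) (x : ℝ) :
    risingFactorial j x * (x + j) = x * risingFactorial j (x + 1) := by
  induction j with
  | zero => simp [risingFactorial_zero]
  | succ j ih =>
    rw [risingFactorial_succ j x, ih, risingFactorial_succ]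
    push_cast
    ring

lemma phiK_eq_sum (k n : ℕ) {r s : ℝ} (hs : s ≠ 0) :
    phiK k n r s = ∑ j ∈ Finset.range k, Ckn k n * phiCoeff k n j
      * r ^ (2 * (j : ℤ)) * s ^ (2 * (k : ℤ) - 2 - n - 2 * j) := by
  rw [phiK, Finset.mul_sum]
  refine Finset.sum_congr rfl fun j _ => ?_
  rw [zpow_sub₀ hs _ (2 * (j : ℤ)), div_pow, phiCoeff,
    show 2 * (j : ℤ) = ((2 * j : ℕ) : ℤ) by push_cast; ring, zpow_natCast, zpow_natCast]
  ring

lemma phiK_one {n : ℕ} (hn : 0 < n) (r s : ℝ) : phiK 1 n r s = s ^ (-(n : ℤ)) / n := by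
  have hn' : (0 : ℝ) < n := by exact_mod_cast hn
  have hG : Real.Gamma ((n : ℝ) / 2) ≠ 0 := (Real.Gamma_pos_of_pos (by positivity)).ne'
  simp [phiK, Ckn, risingFactorial_zero, Real.Gamma_add_one (div_pos hn' two_pos).ne']
  field_simp

lemma half_sub_pos {k n : ℕ} (hkn : 2 * k < n) : (0 : ℝ) < (n : ℝ) / 2 - k := by
  have : ((2 * k : ℕ) : ℝ) < n := by exact_mod_cast hkn
  push_cast at this
  linarith

lemma Ckn_succ {k n : ℕ} (hk : 1 ≤ k) (hkn : 2 * k < n) :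
    Ckn (k + 1) n = Ckn k n / (4 * k * ((n : ℝ) / 2 - k)) := by
  obtain ⟨m, rfl⟩ := Nat.exists_eq_add_of_le' hk
  have hpos : (0 : ℝ) < (n : ℝ) / 2 - (m + 1 : ℕ) := half_sub_pos hkn
  have hG := (Real.Gamma_pos_of_pos hpos).ne'
  have hG' := (Real.Gamma_pos_of_pos (show (0 : ℝ) < (n : ℝ) / 2 + 1 by positivity)).ne'
  rw [Ckn, Ckn, show (n : ℝ) / 2 + 1 - (m + 1 : ℕ) = (n / 2 - (m + 1 : ℕ)) + 1 by ring,
    Real.Gamma_add_one hpos.ne',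
    show (n : ℝ) / 2 + 1 - (m + 1 + 1 : ℕ) = n / 2 - (m + 1 : ℕ) by push_cast; ring,
    show m + 1 + 1 - 1 = m + 1 by omega, Nat.factorial_succ, Nat.add_sub_cancel,
    show 2 * (m + 1 + 1) - 1 = 2 * (m + 1) - 1 + 2 by omega, pow_add]
  generalize (n : ℝ) / 2 - (m + 1 : ℕ) = ν at *
  push_cast
  field_simp
  norm_num

lemma choose_mul_sub_eq_mul_choose_pred {k j : ℕ} (hj : j < k) :
    (k.choose j : ℝ) * (k - j) = k * (k - 1).choose j := by
  obtain ⟨m, rfl⟩ := Nat.exists_eq_add_of_le' (Nat.one_le_of_lt hj)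
  have h := Nat.choose_mul_succ_eq m j
  rw [← Nat.cast_sub hj.le, Nat.add_sub_cancel]
  exact_mod_cast h.symm.trans (mul_comm _ _)

lemma phiCoeff_succ {k n j : ℕ} (hkn : 2 * k < n) (hj : j < k) :
    phiCoeff (k + 1) n j = phiCoeff k n j
      * (k * ((n : ℝ) / 2 - k) / ((k - j) * ((n : ℝ) / 2 - k + j))) := by
  obtain ⟨m, rfl⟩ := Nat.exists_eq_add_of_le' (Nat.one_le_of_lt hj)
  have hpos : (0 : ℝ) < (n : ℝ) / 2 - (m + 1 : ℕ) := half_sub_pos hkn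
  have hkj : (0 : ℝ) < (m + 1 : ℕ) - j := sub_pos.2 (by exact_mod_cast hj)
  have hj0 : (0 : ℝ) ≤ j := j.cast_nonneg
  have hrf := risingFactorial_mul_add j ((n : ℝ) / 2 - (m + 1 : ℕ))
  have hch := choose_mul_sub_eq_mul_choose_pred hj
  rw [phiCoeff, phiCoeff, show (n : ℝ) / 2 + 1 - (m + 1 : ℕ) = (n / 2 - (m + 1 : ℕ)) + 1 by ring,
    show (n : ℝ) / 2 + 1 - (m + 1 + 1 : ℕ) = n / 2 - (m + 1 : ℕ) by push_cast; ring,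
    Nat.add_sub_cancel]
  have h1 := (add_pos_of_pos_of_nonneg hpos hj0).ne'
  rw [← eq_div_iff h1] at hrf
  rw [← eq_div_iff hkj.ne'] at hch
  rw [hrf, hch]
  generalize (n : ℝ) / 2 - (m + 1 : ℕ) = ν at *
  field_simp

/-- Gosper summation of the boundary terms: the partial sums of the alternating series have a
closed form. -/
lemma sum_alternating_choose_mul_risingFactorial (k m : ℕ) {x : ℝ} (hx : 0 < x) :
    ∑ j ∈ Finset.range m, (-1 : ℝ) ^ j * (k.choose j : ℝ)
        * (risingFactorial j (x - k) / risingFactorial j x) * ((k - j) / (x + j) - 1) * k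
      = (-1 : ℝ) ^ m * (k.choose m : ℝ)
        * (risingFactorial m (x - k) / risingFactorial m x) * m := by
  induction m with
  | zero => simp
  | succ m ih =>
    have hch : (k.choose (m + 1) : ℝ) * (m + 1) = k.choose m * (k - m) := by
      have h := Nat.choose_succ_right_eq k m
      rcases le_or_gt m k with hmk | hmk
      · rw [← Nat.cast_sub hmk]
        exact_mod_cast h
      · simp [Nat.choose_eq_zero_of_lt hmk, Nat.choose_eq_zero_of_lt (hmk.trans m.lt_succ_self)]
    have h1 := (risingFactorial_pos m hx).ne'
    have h2 : x + m ≠ 0 := by positivity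
    rw [Finset.sum_range_succ, ih, risingFactorial_succ, risingFactorial_succ]
    push_cast
    rw [show ∀ a b c : ℝ, a * (k.choose (m + 1) : ℝ) * b * c = a * b * (k.choose (m + 1) * c) by
      intros; ring, hch]
    field_simp
    ring

lemma sum_phiCoeff_boundary {k n : ℕ} (hk : 1 ≤ k) (hkn : 2 * k < n) :
    Ckn k n / n * ∑ j ∈ Finset.range k,
        phiCoeff k n j * (1 / (n + 2 + 2 * j) - 1 / (2 * k - 2 * j))
      = Ckn (k + 1) n * phiCoeff (k + 1) n k := by
  have hk0 : (0 : ℝ) < k := by exact_mod_cast hk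
  have hn0 : (0 : ℝ) < n := by exact_mod_cast (show 0 < n by omega)
  have hpos : (0 : ℝ) < (n : ℝ) / 2 - k := half_sub_pos hkn
  have hgosper := sum_alternating_choose_mul_risingFactorial k k
    (show (0 : ℝ) < (n : ℝ) / 2 + 1 by positivity)
  have hsum : ∑ j ∈ Finset.range k,
      phiCoeff k n j * (1 / ((n : ℝ) + 2 + 2 * j) - 1 / (2 * k - 2 * j))
        = (-1) ^ k * (risingFactorial k ((n : ℝ) / 2 + 1 - k)
          / risingFactorial k ((n : ℝ) / 2 + 1)) / (2 * k) := by
    rw [Nat.choose_self, Nat.cast_one, mul_one] at hgosper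
    rw [eq_div_iff (by positivity), ← mul_right_cancel_iff_of_pos hk0, ← hgosper,
      Finset.sum_mul, Finset.sum_mul]
    refine Finset.sum_congr rfl fun j hj => ?_
    have hj := Finset.mem_range.1 hj
    have hkj : (0 : ℝ) < k - j := sub_pos.2 (by exact_mod_cast hj)
    have hch := choose_mul_sub_eq_mul_choose_pred hj
    rw [← eq_div_iff hkj.ne'] at hch
    rw [phiCoeff, hch, show (2 : ℝ) * k - 2 * j = 2 * (k - j) by ring,
      show (n : ℝ) + 2 + 2 * j = 2 * (n / 2 + 1 + j) by ring]
    have h1 : (n : ℝ) / 2 + 1 + j ≠ 0 := by positivity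
    field_simp
  have hrf := risingFactorial_mul_add k ((n : ℝ) / 2 - k)
  rw [sub_add_cancel, ← eq_div_iff (by positivity)] at hrf
  have hD := (risingFactorial_pos k (show (0 : ℝ) < (n : ℝ) / 2 + 1 by positivity)).ne'
  rw [hsum, Ckn_succ hk hkn, phiCoeff, Nat.add_sub_cancel, Nat.choose_self,
    show (n : ℝ) / 2 + 1 - (k + 1 : ℕ) = n / 2 - k by push_cast; ring, hrf,
    show (n : ℝ) / 2 + 1 - k = n / 2 - k + 1 by ring]
  generalize risingFactorial k ((n : ℝ) / 2 - k + 1) = A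
  have hne := hpos.ne'
  obtain ⟨ν, hν⟩ : ∃ ν, ν = (n : ℝ) / 2 - k := ⟨_, rfl⟩
  rw [← hν] at hne ⊢
  field_simp
  norm_num

lemma integrableOn_and_integral_of_eqOn_sum_zpow {S : Set ℝ} (hS : MeasurableSet S) {f : ℝ → ℝ}
    {k : ℕ} {c v : ℕ → ℝ} {e : ℕ → ℤ}
    (hf : Set.EqOn f (fun σ => ∑ j ∈ Finset.range k, c j * σ ^ e j) S)
    (hi : ∀ j < k, IntegrableOn (fun σ : ℝ => σ ^ e j) S ∧ ∫ σ in S, σ ^ e j = v j) :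
    IntegrableOn f S ∧ ∫ σ in S, f σ = ∑ j ∈ Finset.range k, c j * v j := by
  have hi' : ∀ j ∈ Finset.range k, IntegrableOn (fun σ : ℝ => c j * σ ^ e j) S := fun j hj =>
    (hi j (Finset.mem_range.1 hj)).1.const_mul _
  refine ⟨IntegrableOn.congr_fun (integrable_finsetSum _ hi') hf.symm hS, ?_⟩
  rw [setIntegral_congr_fun hS hf, integral_finsetSum _ hi']
  refine Finset.sum_congr rfl fun j hj => ?_
  rw [integral_const_mul, (hi j (Finset.mem_range.1 hj)).2]

lemma zpow_Ioc_of_pos {a b : ℝ} (ha : 0 < a) (hab : a ≤ b) {e : ℤ} (he : e ≠ -1) :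
    IntegrableOn (fun σ : ℝ => σ ^ e) (Set.Ioc a b) ∧
      ∫ σ in Set.Ioc a b, σ ^ e = (b ^ (e + 1) - a ^ (e + 1)) / (e + 1) := by
  have h0 : (0 : ℝ) ∉ Set.uIcc a b := by
    rw [Set.uIcc_of_le hab]
    exact fun h => ha.not_ge h.1
  refine ⟨?_, ?_⟩
  · rw [← intervalIntegrable_iff_integrableOn_Ioc_of_le hab]
    exact intervalIntegral.intervalIntegrable_zpow (Or.inr h0)
  · rw [← intervalIntegral.integral_of_le hab, integral_zpow (Or.inr ⟨he, h0⟩)]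

lemma zpow_Ioc_zero {b : ℝ} (hb : 0 ≤ b) {e : ℤ} (he : 0 ≤ e) :
    IntegrableOn (fun σ : ℝ => σ ^ e) (Set.Ioc 0 b) ∧
      ∫ σ in Set.Ioc 0 b, σ ^ e = b ^ (e + 1) / (e + 1) := by
  refine ⟨?_, ?_⟩
  · rw [← intervalIntegrable_iff_integrableOn_Ioc_of_le hb]
    exact intervalIntegral.intervalIntegrable_zpow (Or.inl he)
  · rw [← intervalIntegral.integral_of_le hb, integral_zpow (Or.inl he),
      zero_zpow _ (by omega), sub_zero]

lemma zpow_Ioi {a : ℝ} (ha : 0 < a) {e : ℤ} (he : e < -1) :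
    IntegrableOn (fun σ : ℝ => σ ^ e) (Set.Ioi a) ∧
      ∫ σ in Set.Ioi a, σ ^ e = -a ^ (e + 1) / (e + 1) := by
  have he' : (e : ℝ) < -1 := by exact_mod_cast he
  have h1 := integrableOn_Ioi_rpow_of_lt he' ha
  have h2 := integral_Ioi_rpow_of_lt he' ha
  rw [show (e : ℝ) + 1 = ((e + 1 : ℤ) : ℝ) by push_cast; ring] at h2
  simp only [Real.rpow_intCast] at h1 h2
  exact ⟨h1, by rw [h2]; push_cast; rfl⟩

/-- The convolution identity producing the Green-function factor of
`(-Δ)^{k+1}` from that of `(-Δ)^k`: for `1 ≤ k`, `2k < n`, and `0 < r ≤ s`, the function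
`σ ↦ σ^{n+1} φ̂_k(σ,r) φ̂_1(σ,s)` is integrable on `(0,∞)` and its integral equals
`φ_{k+1}(r,s)`. -/
theorem phi_convolution_identity
    (n k : ℕ) (hk : 1 ≤ k) (hkn : 2 * k < n) :
    ∀ r s : ℝ, 0 < r → r ≤ s →
      IntegrableOn (fun σ : ℝ => σ ^ (n + 1) * phiKHat k n σ r * phiKHat 1 n σ s)
        (Set.Ioi (0:ℝ)) ∧
      (∫ σ in Set.Ioi (0:ℝ), σ ^ (n + 1) * phiKHat k n σ r * phiKHat 1 n σ s)
        = phiK (k + 1) n r s := by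
  intro r s hr hrs
  have hs : 0 < s := hr.trans_le hrs
  have hn : 0 < n := by omega
  set f : ℝ → ℝ := fun σ => σ ^ (n + 1) * phiKHat k n σ r * phiKHat 1 n σ s with hf
  obtain ⟨iA, eA⟩ := integrableOn_and_integral_of_eqOn_sum_zpow (S := Set.Ioc 0 r) (f := f)
    (k := k) (c := fun j => Ckn k n * phiCoeff k n j * r ^ (2 * (k : ℤ) - 2 - n - 2 * j)
      * (s ^ (-(n : ℤ)) / n)) (e := fun j => n + 1 + 2 * j) measurableSet_Ioc (by
        intro σ ⟨h0, h1⟩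
        simp only [hf, phiKHat, min_eq_left h1, max_eq_right h1, max_eq_right (h1.trans hrs),
          phiK_one hn, phiK_eq_sum k n hr.ne', Finset.mul_sum, Finset.sum_mul]
        refine Finset.sum_congr rfl fun j _ => ?_
        rw [zpow_add₀ h0.ne' ((n : ℤ) + 1), show (n : ℤ) + 1 = ((n + 1 : ℕ) : ℤ) by push_cast; rfl,
          zpow_natCast]
        ring)
    (fun j _ => zpow_Ioc_zero hr.le (by positivity))
  obtain ⟨iB, eB⟩ := integrableOn_and_integral_of_eqOn_sum_zpow (S := Set.Ioc r s) (f := f)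
    (k := k) (c := fun j => Ckn k n * phiCoeff k n j * r ^ (2 * (j : ℤ))
      * (s ^ (-(n : ℤ)) / n)) (e := fun j => 2 * k - 1 - 2 * j) measurableSet_Ioc (by
        intro σ ⟨h0, h1⟩
        have hσ : 0 < σ := hr.trans h0
        simp only [hf, phiKHat, min_eq_right h0.le, max_eq_left h0.le, max_eq_right h1,
          phiK_one hn, phiK_eq_sum k n hσ.ne', Finset.mul_sum, Finset.sum_mul]
        refine Finset.sum_congr rfl fun j _ => ?_
        rw [show 2 * (k : ℤ) - 1 - 2 * j = ((n + 1 : ℕ) : ℤ) + (2 * (k : ℤ) - 2 - n - 2 * j) by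
          push_cast; ring, zpow_add₀ hσ.ne', zpow_natCast]
        ring)
    (fun j _ => zpow_Ioc_of_pos hr hrs (by omega))
  obtain ⟨iC, eC⟩ := integrableOn_and_integral_of_eqOn_sum_zpow (S := Set.Ioi s) (f := f)
    (k := k) (c := fun j => Ckn k n * phiCoeff k n j * r ^ (2 * (j : ℤ)) / n)
    (e := fun j => 2 * k - 1 - n - 2 * j) measurableSet_Ioi (by
        intro σ h0
        have h0 : s < σ := h0
        have hσ : 0 < σ := hs.trans h0
        simp only [hf, phiKHat, min_eq_right (hrs.trans h0.le), max_eq_left (hrs.trans h0.le),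
          max_eq_left h0.le,
          phiK_one hn, phiK_eq_sum k n hσ.ne', Finset.mul_sum, Finset.sum_mul]
        refine Finset.sum_congr rfl fun j _ => ?_
        rw [show 2 * (k : ℤ) - 1 - n - 2 * j
            = ((n + 1 : ℕ) : ℤ) + (2 * (k : ℤ) - 2 - n - 2 * j) + -(n : ℤ) by push_cast; ring,
          zpow_add₀ hσ.ne', zpow_add₀ hσ.ne', zpow_natCast]
        ring)
    (fun j hj => zpow_Ioi hs (by omega))
  have iBC : IntegrableOn f (Set.Ioi r) := by
    rw [← Set.Ioc_union_Ioi_eq_Ioi hrs]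
    exact iB.union iC
  rw [← Set.Ioc_union_Ioi_eq_Ioi hr.le]
  refine ⟨iA.union iBC, ?_⟩
  rw [setIntegral_union (Set.Ioc_disjoint_Ioi le_rfl) measurableSet_Ioi iA iBC,
    ← Set.Ioc_union_Ioi_eq_Ioi hrs,
    setIntegral_union (Set.Ioc_disjoint_Ioi le_rfl) measurableSet_Ioi iB iC, eA, eB, eC,
    phiK_eq_sum _ _ hs.ne', Finset.sum_range_succ, ← sum_phiCoeff_boundary hk hkn,
    Finset.mul_sum, Finset.sum_mul, Finset.sum_mul, ← Finset.sum_add_distrib,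
    ← Finset.sum_add_distrib, ← Finset.sum_add_distrib]
  refine Finset.sum_congr rfl fun j hj => ?_
  have hj : j < k := Finset.mem_range.1 hj
  have hkj : (0 : ℝ) < k - j := sub_pos.2 (by exact_mod_cast hj)
  have hpos : (0 : ℝ) < (n : ℝ) / 2 - k := half_sub_pos hkn
  have hνj : (n : ℝ) / 2 - k + j ≠ 0 := by positivity
  have hrA : r ^ (2 * (k : ℤ) - 2 - n - 2 * j) * r ^ ((n : ℤ) + 1 + 2 * j + 1)
      = r ^ (2 * (k : ℤ)) := by
    rw [← zpow_add₀ hr.ne']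
    congr 1
    ring
  have hrB : r ^ (2 * (j : ℤ)) * r ^ (2 * (k : ℤ) - 1 - 2 * j + 1) = r ^ (2 * (k : ℤ)) := by
    rw [← zpow_add₀ hr.ne']
    congr 1
    ring
  have hsB : s ^ (-(n : ℤ)) * s ^ (2 * (k : ℤ) - 1 - 2 * j + 1)
      = s ^ (2 * (k : ℤ) - 1 - n - 2 * j + 1) := by
    rw [← zpow_add₀ hs.ne']
    congr 1
    ring
  rw [Ckn_succ hk hkn, phiCoeff_succ hkn hj,
    show 2 * ((k + 1 : ℕ) : ℤ) - 2 - n - 2 * j = 2 * (k : ℤ) - 1 - n - 2 * j + 1 by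
      push_cast; ring,
    show 2 * ((k + 1 : ℕ) : ℤ) - 2 - n - 2 * k = -(n : ℤ) by push_cast; ring]
  push_cast
  generalize s ^ (2 * (k : ℤ) - 1 - n - 2 * j + 1) = S at *
  have hC : (1 / (2 * k - 2 * j) - 1 / (2 * k - 1 - n - 2 * j + 1)) / (n : ℝ)
      = 1 / (4 * (k - j) * (n / 2 - k + j)) := by
    have h1 : (2 : ℝ) * k - 2 * j = 2 * (k - j) := by ring
    have h2 : (2 : ℝ) * k - 1 - n - 2 * j + 1 = -(2 * (n / 2 - k + j)) := by ring
    rw [h1, h2]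
    obtain ⟨μ, hμ⟩ : ∃ μ, μ = (n : ℝ) / 2 - k + j := ⟨_, rfl⟩
    rw [← hμ] at hνj ⊢
    field_simp
    linear_combination 4 * hμ
  have hR : 1 / (4 * k * ((n : ℝ) / 2 - k))
      * (k * ((n : ℝ) / 2 - k) / ((k - j) * ((n : ℝ) / 2 - k + j)))
      = 1 / (4 * (k - j) * (n / 2 - k + j)) := by
    have hk0 : (k : ℝ) ≠ 0 := by exact_mod_cast (show k ≠ 0 by omega)
    generalize (n : ℝ) / 2 - k = ν at hpos hνj ⊢
    field_simp
  rw [← hC] at hR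
  rw [show (n : ℝ) + 1 + 2 * j + 1 = n + 2 + 2 * j by ring,
    show (2 : ℝ) * k - 1 - 2 * j + 1 = 2 * k - 2 * j by ring]
  linear_combination (Ckn k n * phiCoeff k n j / n) * (s ^ (-(n : ℤ)) / (n + 2 + 2 * j) * hrA
    + r ^ (2 * (j : ℤ)) / (2 * k - 2 * j) * hsB - s ^ (-(n : ℤ)) / (2 * k - 2 * j) * hrB)
    - Ckn k n * phiCoeff k n j * r ^ (2 * (j : ℤ)) * S * hR
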